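/- Let k ≥ 1, let ε ≥ 0 satisfy ν e_j ≤ ε for all 1 ≤ j ≤ k, and assume the series Σ_{i=0}^∞ γ^i c(i+m) converges. Then μ(v_{π*} − v_{k,m}) ≤ (C_{π*}/(1−γ)) k ε + γ^m (Σ_{i=0}^∞ γ^i c(i+m)) ⌈k/m⌉ ε + 2 γ^k Vmax; that is, with C^{(1,m)} = (1−γ)Σ_{i≥0}γ^i c(i+m), μ(v_{π*} − v_{k,m}) ≤ (C_{π*}/(1−γ)) k ε + (γ^m C^{(1,m)}/(1−γ)) ⌈k/m⌉ ε + 2 γ^k Vmax. -/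

import Mathlib

open Finset Matrix

noncomputable section

/-- Transition matrix of a deterministic stationary policy. -/
def polMat {S A : Type*} (P : S → A → S → ℝ) (π : S → A) : Matrix S S ℝ :=
  Matrix.of fun s s' => P s (π s) s'

/-- Bellman operator `T_π v = r + γ P_π v` of a deterministic stationary policy. -/
def bOp {S A : Type*} [Fintype S] (P : S → A → S → ℝ) (γ : ℝ) (r : S → ℝ)
    (π : S → A) (v : S → ℝ) : S → ℝ :=
  fun s => r s + γ * ∑ s' : S, P s (π s) s' * v s'

/-- `errOf P γ r v π = max_{π'} T_{π'} v − T_π v` (componentwise maximum over all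
deterministic stationary policies `π'`). -/
def errOf {S A : Type*} [Fintype S] [Fintype A] [DecidableEq S] [Nonempty A]
    (P : S → A → S → ℝ) (γ : ℝ) (r : S → ℝ) (v : S → ℝ) (π : S → A) : S → ℝ :=
  fun s => (Finset.univ.sup' Finset.univ_nonempty fun π' : S → A => bOp P γ r π' v s)
    - bOp P γ r π v s

/-- Values of the PSDP∞ non-stationary policies: `vSig P γ r πseq k = v_{σ_k}
= T_{π_k} T_{π_{k-1}} ⋯ T_{π_1} r` (so `vSig P γ r πseq 0 = r`). -/
def vSig {S A : Type*} [Fintype S] (P : S → A → S → ℝ) (γ : ℝ) (r : S → ℝ)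
    (πseq : ℕ → S → A) : ℕ → S → ℝ
  | 0 => r
  | k+1 => bOp P γ r (πseq (k+1)) (vSig P γ r πseq k)


/-- The composed NSPI operator
`nsRun P γ r πseq j m v = T_{π_j} T_{π_{j−1}} ⋯ T_{π_{j−m+1}} v` (identity for `m = 0`). -/
def nsRun {S A : Type*} [Fintype S] (P : S → A → S → ℝ) (γ : ℝ) (r : S → ℝ)
    (πseq : ℤ → S → A) : ℤ → ℕ → (S → ℝ) → (S → ℝ)
  | _, 0, v => v
  | j, m+1, v => bOp P γ r (πseq j) (nsRun P γ r πseq (j-1) m v)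

/-- `gamMat P γ πseq j m = Γ_{j,m} = (γP_{π_j})(γP_{π_{j−1}})⋯(γP_{π_{j−m+1}})`. -/
def gamMat {S A : Type*} [Fintype S] [DecidableEq S]
    (P : S → A → S → ℝ) (γ : ℝ) (πseq : ℤ → S → A) (j : ℤ) (m : ℕ) : Matrix S S ℝ :=
  ((List.range m).map fun i => γ • polMat P (πseq (j - (i : ℤ)))).prod

theorem mulVec_mono_of_nonneg {S : Type*} [Fintype S] {Q : Matrix S S ℝ}
    (hQ : ∀ i j, 0 ≤ Q i j) {x y : S → ℝ} (h : x ≤ y) : Q *ᵥ x ≤ Q *ᵥ y :=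
  fun i => Finset.sum_le_sum fun j _ => mul_le_mul_of_nonneg_left (h j) (hQ i j)

theorem norm_mulVec_le_of_mem_rowStochastic {S : Type*} [Fintype S] [DecidableEq S]
    {Q : Matrix S S ℝ} (hQ : Q ∈ rowStochastic ℝ S) (x : S → ℝ) : ‖Q *ᵥ x‖ ≤ ‖x‖ := by
  refine (pi_norm_le_iff_of_nonneg (norm_nonneg x)).2 fun i => ?_
  calc ‖(Q *ᵥ x) i‖ ≤ ∑ j, ‖Q i j * x j‖ := norm_sum_le _ _
    _ ≤ ∑ j, Q i j * ‖x‖ := Finset.sum_le_sum fun j _ => by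
        rw [norm_mul, Real.norm_of_nonneg (hQ.1 i j)]
        exact mul_le_mul_of_nonneg_left (norm_le_pi_norm x j) (hQ.1 i j)
    _ = ‖x‖ := by rw [← Finset.sum_mul, sum_row_of_mem_rowStochastic hQ, one_mul]

theorem dotProduct_le_norm_of_sum_eq_one {S : Type*} [Fintype S] {μ : S → ℝ}
    (hμ0 : ∀ s, 0 ≤ μ s) (hμ1 : ∑ s, μ s = 1) (x : S → ℝ) : μ ⬝ᵥ x ≤ ‖x‖ :=
  calc μ ⬝ᵥ x ≤ ∑ s, μ s * ‖x‖ := Finset.sum_le_sum fun s _ =>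
        mul_le_mul_of_nonneg_left ((le_abs_self _).trans (norm_le_pi_norm x s)) (hμ0 s)
    _ = ‖x‖ := by rw [← Finset.sum_mul, hμ1, one_mul]

theorem le_sum_pow_mulVec_add {S : Type*} [Fintype S] [DecidableEq S] {M : Matrix S S ℝ}
    (hM : ∀ i j, 0 ≤ M i j) (x b : ℕ → S → ℝ) (h : ∀ n, x (n + 1) ≤ M *ᵥ x n + b (n + 1))
    (n : ℕ) : x n ≤ ∑ i ∈ range n, M ^ i *ᵥ b (n - i) + M ^ n *ᵥ x 0 := by
  induction n with
  | zero => simp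
  | succ n ih =>
    refine (h n).trans ((add_le_add_left (mulVec_mono_of_nonneg hM ih) _).trans_eq ?_)
    rw [Finset.sum_range_succ', mulVec_add, mulVec_sum]
    simp only [mulVec_mulVec, ← pow_succ', Nat.add_sub_add_right, pow_zero, one_mulVec,
      Nat.sub_zero]
    abel

theorem sum_range_mul_eq {M : Type*} [AddCommMonoid M] (f : ℕ → M) (m K : ℕ) :
    ∑ i ∈ range (m * K), f i = ∑ p ∈ range K, ∑ s ∈ range m, f (m * p + s) := by
  induction K with
  | zero => simp
  | succ K ih => rw [Nat.mul_succ, Finset.sum_range_add, ih, Finset.sum_range_succ]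

theorem sum_sum_add_mul_le {a : ℕ → ℝ} (ha : ∀ n, 0 ≤ a n) (hs : Summable a)
    {k m K : ℕ} (hk : k ≤ m * K) (N : ℕ) :
    ∑ i ∈ range k, ∑ q ∈ range N, a (i + m * q) ≤ K * ∑' n, a n := by
  have hblock : ∀ p, ∑ s ∈ range m, ∑ q ∈ range N, a (m * p + s + m * q) ≤ ∑' n, a n := by
    intro p
    calc ∑ s ∈ range m, ∑ q ∈ range N, a (m * p + s + m * q)
        = ∑ q ∈ range N, ∑ s ∈ range m, a (m * p + (m * q + s)) := by
          rw [Finset.sum_comm]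
          refine Finset.sum_congr rfl fun q _ => Finset.sum_congr rfl fun s _ => ?_
          congr 1
          ring
      _ = ∑ n ∈ range (m * N), a (m * p + n) :=
          (sum_range_mul_eq (fun n => a (m * p + n)) m N).symm
      _ ≤ ∑ n ∈ range (m * p + m * N), a n := by
          rw [Finset.sum_range_add]
          exact le_add_of_nonneg_left (Finset.sum_nonneg fun n _ => ha n)
      _ ≤ ∑' n, a n := hs.sum_le_tsum _ fun n _ => ha n
  calc ∑ i ∈ range k, ∑ q ∈ range N, a (i + m * q)
      ≤ ∑ i ∈ range (m * K), ∑ q ∈ range N, a (i + m * q) :=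
        Finset.sum_le_sum_of_subset_of_nonneg (Finset.range_subset_range.2 hk)
          fun i _ _ => Finset.sum_nonneg fun q _ => ha _
    _ = ∑ p ∈ range K, ∑ s ∈ range m, ∑ q ∈ range N, a (m * p + s + m * q) :=
        sum_range_mul_eq _ m K
    _ ≤ ∑ _p ∈ range K, ∑' n, a n := Finset.sum_le_sum fun p _ => hblock p
    _ = K * ∑' n, a n := by simp

theorem isUnit_one_sub_smul_of_mem_rowStochastic {S : Type*} [Fintype S] [DecidableEq S]
    {Q : Matrix S S ℝ} (hQ : Q ∈ rowStochastic ℝ S) {γ : ℝ} (hγ0 : 0 ≤ γ) (hγ1 : γ < 1) :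
    IsUnit (1 - γ • Q).det := by
  rw [isUnit_iff_ne_zero]
  intro hdet
  obtain ⟨v, hv0, hv⟩ := exists_mulVec_eq_zero_iff.2 hdet
  rw [sub_mulVec, one_mulVec, smul_mulVec, sub_eq_zero] at hv
  have h1 : ‖v‖ ≤ γ * ‖v‖ := by
    calc ‖v‖ = γ * ‖Q *ᵥ v‖ := by
          conv_lhs => rw [hv]
          rw [norm_smul, Real.norm_of_nonneg hγ0]
      _ ≤ γ * ‖v‖ :=
        mul_le_mul_of_nonneg_left (norm_mulVec_le_of_mem_rowStochastic hQ v) hγ0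
  nlinarith [norm_pos_iff.2 hv0]

/-- Partial sums of the Neumann series of `μ (1 - γ Q)⁻¹` increase to it. -/
theorem sum_vecMul_pow_le {S : Type*} [Fintype S] [DecidableEq S]
    {Q : Matrix S S ℝ} (hQ : Q ∈ rowStochastic ℝ S) {γ : ℝ} (hγ0 : 0 ≤ γ) (hγ1 : γ < 1)
    {μ : S → ℝ} (hμ0 : ∀ s, 0 ≤ μ s) (i : ℕ) (s : S) :
    (μ ᵥ* (γ • Q) ^ i) s ≤ (μ ᵥ* (1 - γ • Q)⁻¹) s := by
  set W := μ ᵥ* (1 - γ • Q)⁻¹ with hW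
  have hterm : ∀ n s, 0 ≤ (μ ᵥ* (γ • Q) ^ n) s := by
    intro n s
    rw [smul_pow, vecMul_smul]
    exact mul_nonneg (pow_nonneg hγ0 n)
      (nonneg_vecMul_of_mem_rowStochastic (pow_mem hQ n) hμ0 s)
  have hrec : W = μ + W ᵥ* (γ • Q) := by
    have h : W ᵥ* (1 - γ • Q) = μ := by
      rw [hW, vecMul_vecMul,
        nonsing_inv_mul _ (isUnit_one_sub_smul_of_mem_rowStochastic hQ hγ0 hγ1), vecMul_one]
    rw [vecMul_sub, vecMul_one] at h
    exact sub_eq_iff_eq_add.1 h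
  have hexp : ∀ n, W = ∑ i ∈ range n, μ ᵥ* (γ • Q) ^ i + W ᵥ* (γ • Q) ^ n := by
    intro n
    induction n with
    | zero => simp
    | succ n ih =>
      have h : W ᵥ* (γ • Q) ^ n = μ ᵥ* (γ • Q) ^ n + W ᵥ* (γ • Q) ^ (n + 1) := by
        conv_lhs => rw [hrec]
        rw [add_vecMul, vecMul_vecMul, pow_succ']
      rw [Finset.sum_range_succ, add_assoc, ← h]
      exact ih
  have hrem : ∀ n, -(γ ^ n * ∑ t, |W t|) ≤ (W ᵥ* (γ • Q) ^ n) s := by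
    intro n
    rw [smul_pow, vecMul_smul, Pi.smul_apply, smul_eq_mul, ← mul_neg]
    refine mul_le_mul_of_nonneg_left ?_ (pow_nonneg hγ0 n)
    rw [← Finset.sum_neg_distrib]
    refine Finset.sum_le_sum fun t _ => ?_
    have h0 : 0 ≤ (Q ^ n) t s := nonneg_of_mem_rowStochastic (pow_mem hQ n)
    have h1 : (Q ^ n) t s ≤ 1 := le_one_of_mem_rowStochastic (pow_mem hQ n)
    nlinarith [neg_abs_le (W t), abs_nonneg (W t)]
  have hbound : ∀ᶠ n in Filter.atTop,
      (μ ᵥ* (γ • Q) ^ i) s - γ ^ n * ∑ t, |W t| ≤ W s := by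
    filter_upwards [Filter.eventually_gt_atTop i] with n hn
    have h := congrFun (hexp n) s
    rw [Pi.add_apply, Finset.sum_apply] at h
    have h2 := Finset.single_le_sum (f := fun j => (μ ᵥ* (γ • Q) ^ j) s)
      (fun j _ => hterm j s) (Finset.mem_range.2 hn)
    have h3 := hrem n
    linarith
  refine le_of_tendsto ?_ hbound
  simpa using ((tendsto_pow_atTop_nhds_zero_of_lt_one hγ0 hγ1).mul_const
    (∑ t, |W t|)).const_sub ((μ ᵥ* (γ • Q) ^ i) s)

/-- The policies `π_j, π_{j-1}, …, π_{j-m+1}` applied by `nsRun`. -/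
def loopPolicies {S A : Type*} (πseq : ℤ → S → A) (j : ℤ) (m : ℕ) : List (S → A) :=
  (List.range m).map fun i : ℕ => πseq (j - (i : ℤ))

theorem loopPolicies_succ {S A : Type*} (πseq : ℤ → S → A) (j : ℤ) (m : ℕ) :
    loopPolicies πseq j (m + 1) = πseq j :: loopPolicies πseq (j - 1) m := by
  simp only [loopPolicies, List.range_succ_eq_map, List.map_cons, List.map_map]
  congr 1
  · simp
  · refine List.map_congr_left fun i _ => ?_
    simp only [Function.comp_apply]
    congr 1
    push_cast
    ring

section MDP

variable {S A : Type*} [Fintype S] {P : S → A → S → ℝ} {γ : ℝ} {r : S → ℝ}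

theorem polMat_mem_rowStochastic [DecidableEq S] (hP0 : ∀ s a s', 0 ≤ P s a s')
    (hP1 : ∀ s a, ∑ s' : S, P s a s' = 1) (π : S → A) : polMat P π ∈ rowStochastic ℝ S :=
  mem_rowStochastic_iff_sum.2 ⟨fun s s' => hP0 s (π s) s', fun s => hP1 s (π s)⟩

theorem prod_polMat_mem_rowStochastic [DecidableEq S] (hP0 : ∀ s a s', 0 ≤ P s a s')
    (hP1 : ∀ s a, ∑ s' : S, P s a s' = 1) (l : List (S → A)) :
    (l.map (polMat P)).prod ∈ rowStochastic ℝ S := by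
  refine Submonoid.list_prod_mem _ fun M hM => ?_
  obtain ⟨π, -, rfl⟩ := List.mem_map.1 hM
  exact polMat_mem_rowStochastic hP0 hP1 π

theorem bOp_eq (π : S → A) (v : S → ℝ) : bOp P γ r π v = r + γ • polMat P π *ᵥ v := by
  ext s
  rfl

theorem bOp_sub_bOp (π : S → A) (u v : S → ℝ) :
    bOp P γ r π u - bOp P γ r π v = γ • polMat P π *ᵥ (u - v) := by
  rw [bOp_eq, bOp_eq, add_sub_add_left_eq_sub, mulVec_sub, smul_sub]

theorem nsRun_sub_nsRun [DecidableEq S] (πseq : ℤ → S → A) (j : ℤ) (m : ℕ) (u v : S → ℝ) :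
    nsRun P γ r πseq j m u - nsRun P γ r πseq j m v
      = (γ ^ m • ((loopPolicies πseq j m).map (polMat P)).prod) *ᵥ (u - v) := by
  induction m generalizing j with
  | zero => simp [nsRun, loopPolicies]
  | succ m ih =>
    simp only [nsRun]
    rw [bOp_sub_bOp, ih, loopPolicies_succ, List.map_cons, List.prod_cons, mulVec_mulVec,
      Matrix.mul_smul, smul_mulVec, smul_mulVec, smul_smul, ← pow_succ']

theorem nsRun_succ_eq (πseq : ℤ → S → A) (j : ℤ) (m : ℕ) (v : S → ℝ) :
    nsRun P γ r πseq j (m + 1) v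
      = nsRun P γ r πseq j m (bOp P γ r (πseq (j - (m : ℤ))) v) := by
  induction m generalizing j with
  | zero => simp [nsRun]
  | succ m ih =>
    rw [nsRun, ih, nsRun]
    congr 4
    push_cast
    ring

theorem norm_bOp_le [DecidableEq S] (hP0 : ∀ s a s', 0 ≤ P s a s')
    (hP1 : ∀ s a, ∑ s' : S, P s a s' = 1) (hγ0 : 0 ≤ γ) (π : S → A) (v : S → ℝ) :
    ‖bOp P γ r π v‖ ≤ ‖r‖ + γ * ‖v‖ := by
  rw [bOp_eq]
  refine (norm_add_le _ _).trans ?_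
  rw [norm_smul, Real.norm_of_nonneg hγ0]
  gcongr
  exact norm_mulVec_le_of_mem_rowStochastic (polMat_mem_rowStochastic hP0 hP1 π) v

theorem norm_nsRun_le [DecidableEq S] (hP0 : ∀ s a s', 0 ≤ P s a s')
    (hP1 : ∀ s a, ∑ s' : S, P s a s' = 1) (hγ0 : 0 ≤ γ) (hγ1 : γ < 1)
    (πseq : ℤ → S → A) (j : ℤ) (m : ℕ) (v : S → ℝ) :
    ‖nsRun P γ r πseq j m v‖ ≤ ‖r‖ / (1 - γ) + γ ^ m * (‖v‖ - ‖r‖ / (1 - γ)) := by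
  induction m generalizing j with
  | zero => simp [nsRun]
  | succ m ih =>
    have hr : ‖r‖ = (1 - γ) * (‖r‖ / (1 - γ)) := by
      rw [mul_div_cancel₀]
      linarith
    have h := mul_le_mul_of_nonneg_left (ih (j - 1)) hγ0
    rw [nsRun, pow_succ']
    refine (norm_bOp_le hP0 hP1 hγ0 _ _).trans ?_
    linarith

theorem norm_le_of_nsRun_eq_self [DecidableEq S] (hP0 : ∀ s a s', 0 ≤ P s a s')
    (hP1 : ∀ s a, ∑ s' : S, P s a s' = 1) (hγ0 : 0 ≤ γ) (hγ1 : γ < 1)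
    {πseq : ℤ → S → A} {j : ℤ} {m : ℕ} (hm : 1 ≤ m) {v : S → ℝ}
    (hv : nsRun P γ r πseq j m v = v) : ‖v‖ ≤ ‖r‖ / (1 - γ) := by
  have h := norm_nsRun_le (r := r) hP0 hP1 hγ0 hγ1 πseq j m v
  rw [hv] at h
  have hγm : γ ^ m < 1 := pow_lt_one₀ hγ0 hγ1 (by omega)
  nlinarith

theorem bOp_le_bOp_add_errOf [Fintype A] [DecidableEq S] [Nonempty A] (π π' : S → A)
    (v : S → ℝ) : bOp P γ r π' v ≤ bOp P γ r π v + errOf P γ r v π := by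
  intro s
  have h := Finset.le_sup' (fun π' : S → A => bOp P γ r π' v s) (Finset.mem_univ π')
  simp only [Pi.add_apply, errOf]
  linarith

theorem errOf_nonneg [Fintype A] [DecidableEq S] [Nonempty A] (π : S → A) (v : S → ℝ) :
    0 ≤ errOf P γ r v π := by
  have h := bOp_le_bOp_add_errOf (P := P) (γ := γ) (r := r) π π v
  exact (le_add_iff_nonneg_right _).1 h

theorem vecMul_prod_polMat_le [DecidableEq S] [Nonempty A] {μ ν : S → ℝ} {c : ℕ → ℝ}
    (hc : ∀ (i : ℕ) (πs : ℕ → S → A) (s : S),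
      Matrix.vecMul μ (((List.range i).map fun t => polMat P (πs t)).prod) s ≤ c i * ν s)
    (l : List (S → A)) : μ ᵥ* (l.map (polMat P)).prod ≤ c l.length • ν := by
  intro s
  have h := hc l.length (fun t => l.getD t fun _ => Classical.arbitrary A) s
  have hl : (List.range l.length).map
      (fun t => polMat P (l.getD t fun _ => Classical.arbitrary A)) = l.map (polMat P) := by
    refine List.ext_getElem (by simp) fun n h1 h2 => ?_
    have hn : n < l.length := by simpa using h2
    simp [hn]
  rw [hl] at h
  exact h

end MDP

theorem dotProduct_mulVec_le_of_vecMul_le {S : Type*} [Fintype S] {μ ν e : S → ℝ} {C ε : ℝ}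
    (hC : 0 ≤ C) {Q : Matrix S S ℝ} (hQ : μ ᵥ* Q ≤ C • ν) (he : 0 ≤ e) (hε : ν ⬝ᵥ e ≤ ε) :
    μ ⬝ᵥ (Q *ᵥ e) ≤ C * ε := by
  rw [dotProduct_mulVec]
  refine (dotProduct_le_dotProduct_of_nonneg_right hQ he).trans ?_
  rw [smul_dotProduct, smul_eq_mul]
  exact mul_le_mul_of_nonneg_left hε hC

/-- for NSPI(m), if `ν e_j ≤ ε` for `1 ≤ j ≤ k` and `Σ_i γ^i c(i+m)` converges,
then `μ(v_{π*} − v_{k,m}) ≤ (C_{π*}/(1−γ)) k ε + γ^m (Σ_i γ^i c(i+m)) ⌈k/m⌉ ε + 2 γ^k Vmax`,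
where `C_{π*}` satisfies `d_{π*,μ} = (1−γ)μ(I−γP_{π*})^{−1} ≤ C_{π*} ν` componentwise. -/
theorem stmt9
    {S A : Type*} [Fintype S] [Fintype A] [DecidableEq S] [Nonempty S] [Nonempty A]
    (P : S → A → S → ℝ) (hP0 : ∀ s a s', 0 ≤ P s a s')
    (hP1 : ∀ s a, ∑ s' : S, P s a s' = 1)
    (γ : ℝ) (hγ0 : 0 < γ) (hγ1 : γ < 1)
    (Rmax Vmax : ℝ) (r : S → ℝ) (hr : ∀ s, |r s| ≤ Rmax)
    (hVmax : Vmax = Rmax / (1 - γ))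
    (πstar : S → A) (vstar : S → ℝ)
    (hfix : bOp P γ r πstar vstar = vstar)
    (hopt : ∀ (π : S → A) (v : S → ℝ), bOp P γ r π v = v → ∀ s, v s ≤ vstar s)
    (μ ν : S → ℝ) (hμ0 : ∀ s, 0 ≤ μ s) (hμ1 : ∑ s : S, μ s = 1)
    (hν0 : ∀ s, 0 ≤ ν s) (hν1 : ∑ s : S, ν s = 1)
    (c : ℕ → ℝ) (hc0 : ∀ i, 0 ≤ c i)
    (hc : ∀ (i : ℕ) (πs : ℕ → S → A) (s : S),
      Matrix.vecMul μ (((List.range i).map fun t => polMat P (πs t)).prod) s ≤ c i * ν s)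
    (Cπ : ℝ) (hCπ0 : 0 ≤ Cπ)
    (hCπ : ∀ s, ((1 - γ) • Matrix.vecMul μ (1 - γ • polMat P πstar)⁻¹) s ≤ Cπ * ν s)
    (m : ℕ) (hm : 1 ≤ m) (πseq : ℤ → S → A)
    (vN : ℕ → S → ℝ)
    (hvN : ∀ j : ℕ, nsRun P γ r πseq (j : ℤ) m (vN j) = vN j)
    (k : ℕ) (hk : 1 ≤ k)
    (ε : ℝ) (hε : 0 ≤ ε)
    (herr : ∀ j, 1 ≤ j → j ≤ k →
      (∑ s : S, ν s * errOf P γ r (vN (j - 1)) (πseq (j : ℤ)) s) ≤ ε)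
    (hsum : Summable fun i : ℕ => γ ^ i * c (i + m)) :
    (∑ s : S, μ s * (vstar s - vN k s)) ≤
      Cπ / (1 - γ) * k * ε
        + γ ^ m * (∑' i : ℕ, γ ^ i * c (i + m)) * ((⌈(k : ℝ) / (m : ℝ)⌉ : ℤ) : ℝ) * ε
        + 2 * γ ^ k * Vmax := by
  have h1γ : 0 < 1 - γ := by linarith
  have hQ := polMat_mem_rowStochastic hP0 hP1 πstar
  set Q := polMat P πstar with hQdef
  set L : ℕ → Matrix S S ℝ := fun j => ((loopPolicies πseq j m).map (polMat P)).prod with hLdef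
  have hL : ∀ j, L j ∈ rowStochastic ℝ S := fun j => prod_polMat_mem_rowStochastic hP0 hP1 _
  set e : ℕ → S → ℝ := fun j => errOf P γ r (vN (j - 1)) (πseq (j : ℤ)) with hedef
  set d : ℕ → S → ℝ := fun j => bOp P γ r (πseq (j : ℤ)) (vN (j - 1)) - vN j with hddef
  have he0 : ∀ j, 0 ≤ e j := fun j => errOf_nonneg _ _
  have hQnonneg : ∀ s s', 0 ≤ (γ • Q) s s' := fun s s' => mul_nonneg hγ0.le (hQ.1 s s')
  have hΓnonneg : ∀ j s s', 0 ≤ (γ ^ m • L j) s s' := fun j s s' =>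
    mul_nonneg (pow_nonneg hγ0.le m) ((hL j).1 s s')
  have hstep : ∀ n, vstar - vN (n + 1)
      ≤ (γ • Q) *ᵥ (vstar - vN n) + (e (n + 1) + d (n + 1)) := by
    intro n
    have h := bOp_le_bOp_add_errOf (P := P) (γ := γ) (r := r) (πseq ((n + 1 : ℕ) : ℤ)) πstar (vN n)
    rw [smul_mulVec, ← bOp_sub_bOp (r := r), hfix]
    intro s
    have hs := h s
    simp only [hedef, hddef, Pi.add_apply, Pi.sub_apply, Nat.add_sub_cancel] at hs ⊢
    linarith
  have hdstep : ∀ n, d (n + 1) ≤ (γ ^ m • L (n + 1)) *ᵥ d (n + 1)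
      + (γ ^ m • L (n + 1)) *ᵥ e (n + 1) := by
    intro n
    have hcomm : bOp P γ r (πseq ((n + 1 : ℕ) : ℤ)) (vN n)
        = nsRun P γ r πseq ((n + 1 : ℕ) : ℤ) m
            (bOp P γ r (πseq (((n + 1 : ℕ) : ℤ) - (m : ℤ))) (vN n)) := by
      rw [← nsRun_succ_eq, nsRun]
      have hn : ((n + 1 : ℕ) : ℤ) - 1 = n := by push_cast; ring
      rw [hn, hvN n]
    have hd : d (n + 1) = (γ ^ m • L (n + 1)) *ᵥ
        (bOp P γ r (πseq (((n + 1 : ℕ) : ℤ) - (m : ℤ))) (vN n) - vN (n + 1)) := by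
      rw [← nsRun_sub_nsRun (r := r), hvN (n + 1), ← hcomm]
      rfl
    rw [← mulVec_add]
    conv_lhs => rw [hd]
    refine mulVec_mono_of_nonneg (hΓnonneg _) fun s => ?_
    have hs := bOp_le_bOp_add_errOf (P := P) (γ := γ) (r := r) (πseq ((n + 1 : ℕ) : ℤ))
      (πseq (((n + 1 : ℕ) : ℤ) - (m : ℤ))) (vN n) s
    simp only [hedef, hddef, Pi.add_apply, Pi.sub_apply, Nat.add_sub_cancel] at hs ⊢
    linarith
  have hdsum : ∀ j, 1 ≤ j → ∀ N, d j ≤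
      ∑ q ∈ range N, (γ ^ m • L j) ^ (q + 1) *ᵥ e j + (γ ^ m • L j) ^ N *ᵥ d j := by
    intro j hj N
    obtain ⟨n, rfl⟩ := Nat.exists_eq_add_of_le' hj
    have h := le_sum_pow_mulVec_add (hΓnonneg (n + 1)) (fun _ => d (n + 1))
      (fun _ => (γ ^ m • L (n + 1)) *ᵥ e (n + 1)) (fun _ => hdstep n) N
    simpa only [mulVec_mulVec, ← pow_succ] using h
  have hdirect : ∀ i, ∀ j, 1 ≤ j → j ≤ k →
      μ ⬝ᵥ ((γ • Q) ^ i *ᵥ e j) ≤ Cπ / (1 - γ) * ε := by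
    intro i j hj hjk
    refine dotProduct_mulVec_le_of_vecMul_le (div_nonneg hCπ0 h1γ.le) (fun s => ?_) (he0 j)
      (herr j hj hjk)
    refine (sum_vecMul_pow_le hQ hγ0.le hγ1 hμ0 i s).trans ?_
    have h := hCπ s
    rw [Pi.smul_apply, smul_eq_mul] at h
    rw [Pi.smul_apply, smul_eq_mul, div_mul_eq_mul_div, le_div_iff₀ h1γ]
    linarith
  have hlooped : ∀ i q, ∀ j, 1 ≤ j → j ≤ k →
      μ ⬝ᵥ ((γ • Q) ^ i *ᵥ ((γ ^ m • L j) ^ (q + 1) *ᵥ e j))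
        ≤ γ ^ m * (γ ^ (i + m * q) * c (i + m * q + m)) * ε := by
    intro i q j hj hjk
    set l : List (S → A) := List.replicate i πstar
      ++ (List.replicate (q + 1) (loopPolicies πseq j m)).flatten with hl
    have hlen : l.length = i + m * q + m := by
      simp [hl, loopPolicies]
      ring
    have hprod : (l.map (polMat P)).prod = Q ^ i * L j ^ (q + 1) := by
      simp [hl, hLdef, hQdef, List.map_flatten, List.prod_flatten]
    have hmat : (γ • Q) ^ i * (γ ^ m • L j) ^ (q + 1)
        = γ ^ (i + m * q + m) • (l.map (polMat P)).prod := by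
      rw [hprod, smul_pow, smul_pow, smul_mul_smul_comm, ← pow_mul, ← pow_add]
      congr 2
      ring
    have hle := dotProduct_mulVec_le_of_vecMul_le (hc0 _) (vecMul_prod_polMat_le hc l)
      (he0 j) (herr j hj hjk)
    rw [mulVec_mulVec, hmat, smul_mulVec, dotProduct_smul, smul_eq_mul]
    refine (mul_le_mul_of_nonneg_left hle (pow_nonneg hγ0.le _)).trans_eq ?_
    rw [hlen, pow_add γ (i + m * q) m]
    ring
  have hremainder : ∀ i N j,
      μ ⬝ᵥ ((γ • Q) ^ i *ᵥ ((γ ^ m • L j) ^ N *ᵥ d j)) ≤ (γ ^ m) ^ N * ‖d j‖ := by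
    intro i N j
    refine (dotProduct_le_norm_of_sum_eq_one hμ0 hμ1 _).trans ?_
    rw [smul_pow, smul_pow, smul_mulVec, smul_mulVec, mulVec_smul, norm_smul, norm_smul,
      Real.norm_of_nonneg (pow_nonneg hγ0.le i),
      Real.norm_of_nonneg (pow_nonneg (pow_nonneg hγ0.le m) N)]
    refine (mul_le_of_le_one_left (by positivity) (pow_le_one₀ hγ0.le hγ1.le)).trans ?_
    refine mul_le_mul_of_nonneg_left ?_ (by positivity)
    exact (norm_mulVec_le_of_mem_rowStochastic (pow_mem hQ i) _).trans
      (norm_mulVec_le_of_mem_rowStochastic (pow_mem (hL j) N) _)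
  have hinit : μ ⬝ᵥ ((γ • Q) ^ k *ᵥ (vstar - vN 0)) ≤ 2 * γ ^ k * Vmax := by
    have hrV : ‖r‖ / (1 - γ) ≤ Vmax := by
      rw [hVmax]
      gcongr
      exact (pi_norm_le_iff_of_nonempty r).2 hr
    have hstar : ‖vstar‖ ≤ Vmax :=
      (norm_le_of_nsRun_eq_self (πseq := fun _ => πstar) (j := 0) hP0 hP1 hγ0.le hγ1 le_rfl
        hfix).trans hrV
    have hzero : ‖vN 0‖ ≤ Vmax :=
      (norm_le_of_nsRun_eq_self hP0 hP1 hγ0.le hγ1 hm (hvN 0)).trans hrV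
    refine (dotProduct_le_norm_of_sum_eq_one hμ0 hμ1 _).trans ?_
    rw [smul_pow, smul_mulVec, norm_smul, Real.norm_of_nonneg (pow_nonneg hγ0.le k)]
    have hnorm := (norm_mulVec_le_of_mem_rowStochastic (pow_mem hQ k) (vstar - vN 0)).trans
      (norm_sub_le vstar (vN 0))
    calc γ ^ k * ‖Q ^ k *ᵥ (vstar - vN 0)‖ ≤ γ ^ k * (Vmax + Vmax) := by
          gcongr
          linarith
      _ = 2 * γ ^ k * Vmax := by ring
  have hceil : ((⌈(k : ℝ) / (m : ℝ)⌉ : ℤ) : ℝ) = (⌈(k : ℝ) / (m : ℝ)⌉₊ : ℝ) :=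
    (natCast_ceil_eq_intCast_ceil (by positivity)).symm
  have hkK : k ≤ m * ⌈(k : ℝ) / (m : ℝ)⌉₊ := by
    have hm0 : (0 : ℝ) < m := by exact_mod_cast hm
    have h := (div_le_iff₀' hm0).1 (Nat.le_ceil ((k : ℝ) / (m : ℝ)))
    exact_mod_cast h
  have hmain : ∀ N : ℕ, μ ⬝ᵥ (vstar - vN k) ≤
      Cπ / (1 - γ) * k * ε
        + γ ^ m * (∑' i : ℕ, γ ^ i * c (i + m)) * ((⌈(k : ℝ) / (m : ℝ)⌉ : ℤ) : ℝ) * ε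
        + 2 * γ ^ k * Vmax + (γ ^ m) ^ N * ∑ i ∈ range k, ‖d (k - i)‖ := by
    intro N
    have hterm : ∀ i ∈ range k, μ ⬝ᵥ ((γ • Q) ^ i *ᵥ (e (k - i) + d (k - i))) ≤
        Cπ / (1 - γ) * ε
          + ∑ q ∈ range N, γ ^ m * (γ ^ (i + m * q) * c (i + m * q + m)) * ε
          + (γ ^ m) ^ N * ‖d (k - i)‖ := by
      intro i hi
      have hik := Finset.mem_range.1 hi
      have hj : 1 ≤ k - i := by omega
      have hjk : k - i ≤ k := Nat.sub_le k i
      have hpow : ∀ s s', 0 ≤ ((γ • Q) ^ i) s s' := fun s s' => by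
        rw [smul_pow]
        exact mul_nonneg (pow_nonneg hγ0.le i) ((pow_mem hQ i).1 s s')
      have hd := dotProduct_le_dotProduct_of_nonneg_left
        (mulVec_mono_of_nonneg hpow (hdsum (k - i) hj N)) (w := μ) hμ0
      rw [mulVec_add, dotProduct_add, mulVec_sum, dotProduct_sum] at hd
      have hsums := Finset.sum_le_sum fun q (_ : q ∈ range N) => hlooped i q (k - i) hj hjk
      rw [mulVec_add, dotProduct_add]
      linarith [hdirect i (k - i) hj hjk, hremainder i N (k - i)]
    have hexp := dotProduct_le_dotProduct_of_nonneg_left (w := μ)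
      (le_sum_pow_mulVec_add hQnonneg (fun n => vstar - vN n) (fun n => e n + d n) hstep k) hμ0
    rw [dotProduct_add, dotProduct_sum] at hexp
    have hconst : ∑ _i ∈ range k, Cπ / (1 - γ) * ε = Cπ / (1 - γ) * k * ε := by
      rw [Finset.sum_const, Finset.card_range, nsmul_eq_mul]
      ring
    have hsums := Finset.sum_le_sum hterm
    rw [Finset.sum_add_distrib, Finset.sum_add_distrib, hconst,
      ← Finset.mul_sum (range k) (fun i => ‖d (k - i)‖)] at hsums
    have hcount := sum_sum_add_mul_le (a := fun i => γ ^ i * c (i + m))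
      (fun n => mul_nonneg (pow_nonneg hγ0.le n) (hc0 _)) hsum hkK N
    have hlooptot : ∑ i ∈ range k, ∑ q ∈ range N,
        γ ^ m * (γ ^ (i + m * q) * c (i + m * q + m)) * ε
        ≤ γ ^ m * (∑' i : ℕ, γ ^ i * c (i + m)) * ((⌈(k : ℝ) / (m : ℝ)⌉ : ℤ) : ℝ) * ε := by
      simp only [← Finset.mul_sum, ← Finset.sum_mul]
      rw [hceil, mul_assoc (γ ^ m) (∑' i : ℕ, γ ^ i * c (i + m)), mul_comm (∑' i : ℕ, _)]
      gcongr
    linarith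
  refine ge_of_tendsto' (x := Filter.atTop) ?_ hmain
  simpa using ((tendsto_pow_atTop_nhds_zero_of_lt_one (pow_nonneg hγ0.le m)
    (pow_lt_one₀ hγ0.le hγ1 (by omega))).mul_const
      (∑ i ∈ range k, ‖d (k - i)‖)).const_add
      (Cπ / (1 - γ) * k * ε
        + γ ^ m * (∑' i : ℕ, γ ^ i * c (i + m)) * ((⌈(k : ℝ) / (m : ℝ)⌉ : ℤ) : ℝ) * ε
        + 2 * γ ^ k * Vmax)
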